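/- Let m ≥ 1 and let (a_1,…,a_n) be a sequence of positive integers with border strip 𝒢 = 𝒢[a_1,…,a_n], and let X_𝒢(q) = Λ⁺_m(q,a_1)Λ⁻_m(q,a_2)Λ⁺_m(q,a_3)⋯ (n alternating factors, starting with Λ⁺). Then for all 1 ≤ i,j ≤ m+1: if n is even, X_𝒢(q)_{ij} = q^{m+1−j} · Ω_m^{ij}(𝒢,q), and if n is odd, X_𝒢(q)_{ij} = q^{j−1} · Ω̄_m^{ij}(𝒢,q). -/

import Mathlib

open Polynomial Finset

namespace QHCF

noncomputable section

/-! ### Border strips and P-partitions -/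

/-- The full alternating step list: `replicate a₁ b ++ replicate a₂ (!b) ++ ⋯`. -/
def fullSteps : List ℕ → Bool → List Bool
  | [], _ => []
  | x :: xs, b => List.replicate x b ++ fullSteps xs (!b)

/-- The step sequence of the border strip `𝒢[a₁,…,aₙ]`: `(a₁−1)` up steps (`true`),
then `a₂` right steps (`false`), then `a₃` up steps, alternating, ending with
`(aₙ−1)` final steps. -/
def steps (a : List ℕ) : List Bool := ((fullSteps a true).drop 1).dropLast

/-- The number of boxes `N = a₁+⋯+aₙ−1` of the border strip `𝒢[a₁,…,aₙ]`. -/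
def boxCount (a : List ℕ) : ℕ := a.sum - 1

/-- `σ` is a P-partition on `𝒢[a₁,…,aₙ]` with parts at most `m`:
`σ(t+1) ≤ σ(t)` on up steps and `σ(t) ≤ σ(t+1)` on right steps. -/
def IsPP (m : ℕ) (a : List ℕ) (σ : Fin (boxCount a) → Fin (m + 1)) : Prop :=
  ∀ (t : ℕ) (h : t + 1 < boxCount a),
    if (steps a).getD t true
    then ((σ ⟨t + 1, h⟩ : ℕ) ≤ (σ ⟨t, Nat.lt_of_succ_lt h⟩ : ℕ))
    else ((σ ⟨t, Nat.lt_of_succ_lt h⟩ : ℕ) ≤ (σ ⟨t + 1, h⟩ : ℕ))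

/-- The set of P-partitions on `𝒢[a₁,…,aₙ]` with parts at most `m`. -/
noncomputable def PP (m : ℕ) (a : List ℕ) : Finset (Fin (boxCount a) → Fin (m + 1)) :=
  @Finset.filter _ (IsPP m a) (Classical.decPred _) Finset.univ

/-- The weight of a P-partition: the sum of its parts. -/
def wt {N m : ℕ} (σ : Fin N → Fin (m + 1)) : ℕ := ∑ t, (σ t : ℕ)

/-- The number of P-partitions (parts at most `m`) satisfying a further predicate `p`. -/
noncomputable def PPcount (m : ℕ) (a : List ℕ)
    (p : (Fin (boxCount a) → Fin (m + 1)) → Prop) : ℕ :=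
  (@Finset.filter _ p (Classical.decPred _) (PP m a)).card

/-- The weight generating function `Σ q^{wt σ}` over P-partitions satisfying `p`. -/
noncomputable def PPgen (m : ℕ) (a : List ℕ)
    (p : (Fin (boxCount a) → Fin (m + 1)) → Prop) : Polynomial ℤ :=
  ∑ σ ∈ @Finset.filter _ p (Classical.decPred _) (PP m a), (X : Polynomial ℤ) ^ wt σ

/-- `Ω_m(𝒢,q)`: the weight generating function of all P-partitions with parts at most `m`. -/
noncomputable def Omega (m : ℕ) (a : List ℕ) : Polynomial ℤ := PPgen m a fun _ => True

/-- Generating function over P-partitions with first part `≤ b` and last part `≤ c`. -/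
noncomputable def OmegaLE (m : ℕ) (a : List ℕ) (b c : ℕ) : Polynomial ℤ :=
  PPgen m a fun σ =>
    (∀ h : 0 < boxCount a, (σ ⟨0, h⟩ : ℕ) ≤ b) ∧
    (∀ h : 0 < boxCount a, (σ ⟨boxCount a - 1, Nat.sub_lt h Nat.one_pos⟩ : ℕ) ≤ c)

/-- Generating function over P-partitions with first part `≤ b` and last part `≥ c`. -/
noncomputable def OmegaGE (m : ℕ) (a : List ℕ) (b c : ℕ) : Polynomial ℤ :=
  PPgen m a fun σ =>
    (∀ h : 0 < boxCount a, (σ ⟨0, h⟩ : ℕ) ≤ b) ∧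
    (∀ h : 0 < boxCount a, c ≤ (σ ⟨boxCount a - 1, Nat.sub_lt h Nat.one_pos⟩ : ℕ))

/-! ### Matrices over ℤ -/

/-- `R_m`, the `(m+1)×(m+1)` upper-triangular matrix of ones. -/
def Rmat (m : ℕ) : Matrix (Fin (m + 1)) (Fin (m + 1)) ℤ :=
  Matrix.of fun i j => if i ≤ j then 1 else 0

/-- `W_m`, the antidiagonal permutation matrix (`(W_m)_{ij} = 1` iff `i+j = m+2`, 1-based). -/
def Wmat (m : ℕ) : Matrix (Fin (m + 1)) (Fin (m + 1)) ℤ :=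
  Matrix.of fun i j => if (i : ℕ) + 1 + ((j : ℕ) + 1) = m + 2 then 1 else 0

/-- `Λ_m(a) = R_m^a · W_m`. -/
def Lam (m a : ℕ) : Matrix (Fin (m + 1)) (Fin (m + 1)) ℤ := Rmat m ^ a * Wmat m

/-- The product `Λ_m(a₁)Λ_m(a₂)⋯Λ_m(aₙ)`. -/
def LamProd (m : ℕ) (a : List ℕ) : Matrix (Fin (m + 1)) (Fin (m + 1)) ℤ :=
  (a.map fun x => Lam m x).prod

/-! ### q-deformed matrices over ℤ[q] (with `q = Polynomial.X`) -/

/-- `R_m` as a matrix over `ℤ[q]`. -/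
def RmatQ (m : ℕ) : Matrix (Fin (m + 1)) (Fin (m + 1)) (Polynomial ℤ) :=
  Matrix.of fun i j => if i ≤ j then 1 else 0

/-- `L_m = R_m^⊤` as a matrix over `ℤ[q]`. -/
def LmatQ (m : ℕ) : Matrix (Fin (m + 1)) (Fin (m + 1)) (Polynomial ℤ) := (RmatQ m).transpose

/-- `Q_m = diag(q^m, q^{m-1}, …, q, 1)`. -/
def Qmat (m : ℕ) : Matrix (Fin (m + 1)) (Fin (m + 1)) (Polynomial ℤ) :=
  Matrix.diagonal fun i => X ^ (m - (i : ℕ))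

/-- `R_m(q) := R_m · Q_m`. -/
def Rq (m : ℕ) : Matrix (Fin (m + 1)) (Fin (m + 1)) (Polynomial ℤ) := RmatQ m * Qmat m

/-- `L_m(q) := L_m · Q_m`. -/
def Lq (m : ℕ) : Matrix (Fin (m + 1)) (Fin (m + 1)) (Polynomial ℤ) := LmatQ m * Qmat m

/-- `W_m` as a matrix over `ℤ[q]`. -/
def WmatQ (m : ℕ) : Matrix (Fin (m + 1)) (Fin (m + 1)) (Polynomial ℤ) :=
  Matrix.of fun i j => if (i : ℕ) + 1 + ((j : ℕ) + 1) = m + 2 then 1 else 0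

/-- `Λ⁺_m(q,a) := R_m(q)^a · W_m`. -/
def LamP (m a : ℕ) : Matrix (Fin (m + 1)) (Fin (m + 1)) (Polynomial ℤ) := Rq m ^ a * WmatQ m

/-- `Λ⁻_m(q,a) := W_m · L_m(q)^a`. -/
def LamM (m a : ℕ) : Matrix (Fin (m + 1)) (Fin (m + 1)) (Polynomial ℤ) := WmatQ m * Lq m ^ a

/-- Alternating product of `Λ⁺`/`Λ⁻` matrices (`b = true` starts with `Λ⁺`). -/
def altLam (m : ℕ) : List ℕ → Bool → Matrix (Fin (m + 1)) (Fin (m + 1)) (Polynomial ℤ)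
  | [], _ => 1
  | x :: xs, b => (if b then LamP m x else LamM m x) * altLam m xs (!b)

/-- `X_𝒢(q) = Λ⁺_m(q,a₁)Λ⁻_m(q,a₂)Λ⁺_m(q,a₃)⋯`. -/
def XG (m : ℕ) (a : List ℕ) : Matrix (Fin (m + 1)) (Fin (m + 1)) (Polynomial ℤ) :=
  altLam m a true

/-- Alternating product of powers of `R_m(q)` and `L_m(q)` (`b = true` starts with `R`). -/
def altRL (m : ℕ) : List ℕ → Bool → Matrix (Fin (m + 1)) (Fin (m + 1)) (Polynomial ℤ)
  | [], _ => 1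
  | x :: xs, b => (if b then Rq m ^ x else Lq m ^ x) * altRL m xs (!b)

/-- `R_m(q)^{a₁} L_m(q)^{a₂} R_m(q)^{a₃} ⋯`. -/
def RLProd (m : ℕ) (a : List ℕ) : Matrix (Fin (m + 1)) (Fin (m + 1)) (Polynomial ℤ) :=
  altRL m a true

/-! ### Gaussian binomial coefficients -/

/-- The Gaussian binomial coefficient `binom(n,k)_q ∈ ℤ[q]`, defined via the
q-Pascal recursion `binom(n,k)_q = binom(n−1,k−1)_q + q^k·binom(n−1,k)_q`;
it equals `[n]_q!/([k]_q![n−k]_q!)`. -/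
def qbinom : ℕ → ℕ → Polynomial ℤ
  | _, 0 => 1
  | 0, _ + 1 => 0
  | n + 1, k + 1 => qbinom n k + X ^ (k + 1) * qbinom n (k + 1)

/-- The q-multichoose coefficient `mbinom(n,k)_q := binom(n+k−1,k)_q`. -/
def qmbinom (n k : ℕ) : Polynomial ℤ := qbinom (n + k - 1) k

/-! ### Higher q-continued fractions -/

/-- The higher q-continued fraction
`r^q_{i,m}(a₁,…,aₙ) := Ω_m^{m+1−i,1}(𝒢,q) · (Ω_m^{m+1,1}(𝒢,q))⁻¹ ∈ ℤ⟦q⟧`,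
i.e. the generating function over P-partitions with first part `≤ i`, divided by the
one over P-partitions with first part `= 0` (whose constant term is `1`). -/
noncomputable def rq (m i : ℕ) (a : List ℕ) : PowerSeries ℤ :=
  (↑(OmegaLE m a i m) : PowerSeries ℤ) *
    PowerSeries.invOfUnit (↑(OmegaLE m a 0 m) : PowerSeries ℤ) 1

/-- The value `v(a₁,…,aₙ)` of a finite continued fraction `a₁ + 1/(a₂ + 1/(⋯))`. -/
def cfVal : List ℕ → ℚ
  | [] => 1
  | [x] => (x : ℚ)
  | x :: y :: xs => (x : ℚ) + 1 / cfVal (y :: xs)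

end

end QHCF

open QHCF

namespace QHCF

/-- The relation between consecutive parts imposed by a step (`true` is up, `false` is right). -/
def StepRel (b : Bool) (u v : ℕ) : Prop := if b then v ≤ u else u ≤ v

noncomputable instance (b : Bool) (u v : ℕ) : Decidable (StepRel b u v) := Classical.dec _

/-- The transfer matrix of a step. -/
noncomputable def stepMat (m : ℕ) (b : Bool) :
    Matrix (Fin (m + 1)) (Fin (m + 1)) (Polynomial ℤ) :=
  if b then Rq m else Lq m

/-- The product of the transfer matrices along a list of steps. -/
noncomputable def stepProd (m : ℕ) (l : List Bool) :
    Matrix (Fin (m + 1)) (Fin (m + 1)) (Polynomial ℤ) :=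
  (l.map (stepMat m)).prod

theorem stepMat_rev (m : ℕ) (b : Bool) (u v : Fin (m + 1)) :
    stepMat m b u.rev v.rev = if StepRel b u v then X ^ (v : ℕ) else 0 := by
  have hv : m - (m - (v : ℕ)) = v := by omega
  cases b <;>
    simp [stepMat, Rq, Lq, LmatQ, RmatQ, Qmat, StepRel, Matrix.mul_diagonal, hv]

theorem WmatQ_apply (m : ℕ) (u v : Fin (m + 1)) :
    WmatQ m u v = if u = v.rev then 1 else 0 := by
  have h : ((u : ℕ) + 1 + ((v : ℕ) + 1) = m + 2) ↔ u = v.rev := by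
    rw [Fin.ext_iff, Fin.val_rev]
    omega
  simp [WmatQ, h]

theorem mul_WmatQ_apply (m : ℕ) (M : Matrix (Fin (m + 1)) (Fin (m + 1)) (Polynomial ℤ))
    (u v : Fin (m + 1)) : (M * WmatQ m) u v = M u v.rev := by
  simp [Matrix.mul_apply, WmatQ_apply]

theorem WmatQ_mul_WmatQ (m : ℕ) : WmatQ m * WmatQ m = 1 := by
  ext1 u v
  rw [mul_WmatQ_apply, WmatQ_apply, Fin.rev_rev, Matrix.one_apply]

theorem stepProd_append (m : ℕ) (l l' : List Bool) :
    stepProd m (l ++ l') = stepProd m l * stepProd m l' := by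
  simp [stepProd]

theorem stepProd_replicate (m x : ℕ) (b : Bool) :
    stepProd m (List.replicate x b) = stepMat m b ^ x := by
  simp [stepProd]

theorem altLam_eq_stepProd (m : ℕ) (a : List ℕ) :
    altLam m a true =
        stepProd m (fullSteps a true) * (if Even a.length then 1 else WmatQ m) ∧
      altLam m a false =
        WmatQ m * stepProd m (fullSteps a false) *
          (if Even a.length then WmatQ m else 1) := by
  induction a with
  | nil => simp [altLam, fullSteps, stepProd, WmatQ_mul_WmatQ]
  | cons x xs ih =>
    obtain ⟨ih₁, ih₂⟩ := ih
    constructor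
    · simp only [altLam, fullSteps, Bool.not_true, ih₂, stepProd_append, stepProd_replicate,
        LamP, stepMat, if_true, List.length_cons, Nat.even_add_one, ite_not]
      rw [← mul_assoc, ← mul_assoc, mul_assoc _ (WmatQ m) (WmatQ m), WmatQ_mul_WmatQ, mul_one]
    · simp only [altLam, fullSteps, Bool.not_false, ih₁, stepProd_append, stepProd_replicate,
        LamM, stepMat, Bool.false_eq_true, if_false, List.length_cons, Nat.even_add_one, ite_not,
        mul_assoc]

theorem length_fullSteps (a : List ℕ) (b : Bool) : (fullSteps a b).length = a.sum := by
  induction a generalizing b with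
  | nil => rfl
  | cons x xs ih => simp [fullSteps, ih]

theorem head?_fullSteps {a : List ℕ} (ha : a ≠ []) (hpos : ∀ x ∈ a, 0 < x) (b : Bool) :
    (fullSteps a b).head? = some b := by
  cases a with
  | nil => exact absurd rfl ha
  | cons x xs =>
    have hx : x ≠ 0 := (hpos x (by simp)).ne'
    simp [fullSteps, List.head?_replicate, hx]

theorem getLast?_fullSteps {a : List ℕ} (ha : a ≠ []) (hpos : ∀ x ∈ a, 0 < x) (b : Bool) :
    (fullSteps a b).getLast? = some (if Even a.length then !b else b) := by
  induction a generalizing b with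
  | nil => exact absurd rfl ha
  | cons x xs ih =>
    cases xs with
    | nil =>
      have hx : x ≠ 0 := (hpos x (by simp)).ne'
      simp [fullSteps, List.getLast?_replicate, hx]
    | cons y ys =>
      rw [fullSteps, List.getLast?_append,
        ih (by simp) (fun z hz => hpos z (List.mem_cons_of_mem _ hz))]
      by_cases h : Even (y :: ys).length <;> simp_all [Nat.even_add_one]

theorem fullSteps_eq {a : List ℕ} (ha : a ≠ []) (hpos : ∀ x ∈ a, 0 < x)
    (hN : 0 < boxCount a) :
    fullSteps a true = true :: (steps a ++ [if Even a.length then false else true]) := by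
  have hlen := length_fullSteps a true
  have hhead := head?_fullSteps ha hpos true
  have hlast := getLast?_fullSteps ha hpos true
  unfold boxCount at hN
  unfold steps
  generalize fullSteps a true = l at *
  match l with
  | [] => simp at hhead
  | [_] => simp at hlen; omega
  | c :: d :: l =>
    simp only [List.head?_cons, Option.some.injEq] at hhead
    rw [List.getLast?_cons_cons] at hlast
    subst hhead
    simp only [List.drop_one, List.tail_cons]
    congr 1
    exact (List.dropLast_append_getLast? _ hlast).symm

theorem length_steps (a : List ℕ) : (steps a).length = boxCount a - 1 := by
  simp [steps, length_fullSteps, boxCount]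

/-- Transfer matrix expansion: the entries of a product of step matrices are weight generating
functions of sequences compatible with the steps. -/
theorem stepProd_eq_sum (m : ℕ) (l : List Bool) (b c : Bool) (u w : Fin (m + 1)) (N : ℕ)
    (hN : 0 < N) (hl : l.length + 1 = N)
    [∀ σ : Fin N → Fin (m + 1), Decidable (StepRel b u (σ ⟨0, hN⟩) ∧
      (∀ (t : ℕ) (h : t + 1 < N), StepRel (l.getD t true)
        (σ ⟨t, Nat.lt_of_succ_lt h⟩) (σ ⟨t + 1, h⟩)) ∧
      StepRel c (σ ⟨N - 1, Nat.sub_lt hN Nat.one_pos⟩) w)] :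
    stepProd m (b :: (l ++ [c])) u.rev w.rev =
      X ^ (w : ℕ) * ∑ σ : Fin N → Fin (m + 1),
        if StepRel b u (σ ⟨0, hN⟩) ∧
          (∀ (t : ℕ) (h : t + 1 < N), StepRel (l.getD t true)
            (σ ⟨t, Nat.lt_of_succ_lt h⟩) (σ ⟨t + 1, h⟩)) ∧
          StepRel c (σ ⟨N - 1, Nat.sub_lt hN Nat.one_pos⟩) w
        then (X : Polynomial ℤ) ^ wt σ else 0 := by
  induction l generalizing b u N with
  | nil =>
    obtain rfl : N = 1 := hl.symm
    have : stepProd m (b :: ([] ++ [c])) = stepMat m b * stepMat m c := by simp [stepProd]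
    rw [this, Matrix.mul_apply, ← Equiv.sum_comp Fin.revPerm,
      ← Equiv.sum_comp (Equiv.funUnique (Fin 1) (Fin (m + 1))).symm, mul_sum]
    refine sum_congr rfl fun x _ => ?_
    simp only [Fin.revPerm_apply, stepMat_rev]
    by_cases h₁ : StepRel b u x <;> by_cases h₂ : StepRel c x w <;>
      simp [h₁, h₂, wt, mul_comm]
  | cons d l ih =>
    obtain rfl : N = l.length + 1 + 1 := hl.symm
    have : stepProd m (b :: (d :: l ++ [c])) = stepMat m b * stepProd m (d :: (l ++ [c])) := by
      simp [stepProd]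
    rw [this, Matrix.mul_apply, ← Equiv.sum_comp Fin.revPerm,
      ← Equiv.sum_comp (Fin.consEquiv (fun _ : Fin (l.length + 1 + 1) => Fin (m + 1))),
      Fintype.sum_prod_type, mul_sum]
    refine sum_congr rfl fun x _ => ?_
    classical
    rw [Fin.revPerm_apply, stepMat_rev, ih d x (l.length + 1) (Nat.succ_pos _) rfl,
      mul_left_comm, mul_sum]
    congr 1
    refine sum_congr rfl fun σ _ => ?_
    have hwt : wt (Fin.cons x σ : Fin (l.length + 1 + 1) → Fin (m + 1)) = x + wt σ := by
      simp [wt, Fin.sum_univ_succ]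
    have hmid : (∀ (t : ℕ) (h : t + 1 < l.length + 1 + 1), StepRel ((d :: l).getD t true)
          ((Fin.cons x σ : Fin (l.length + 1 + 1) → Fin (m + 1)) ⟨t, Nat.lt_of_succ_lt h⟩)
          ((Fin.cons x σ : Fin (l.length + 1 + 1) → Fin (m + 1)) ⟨t + 1, h⟩)) ↔
        StepRel d x (σ ⟨0, Nat.succ_pos _⟩) ∧
          ∀ (t : ℕ) (h : t + 1 < l.length + 1), StepRel (l.getD t true)
            (σ ⟨t, Nat.lt_of_succ_lt h⟩) (σ ⟨t + 1, h⟩) := by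
      constructor
      · exact fun H => ⟨H 0 (Nat.succ_lt_succ (Nat.succ_pos _)), fun t h => H (t + 1) (Nat.succ_lt_succ h)⟩
      · rintro ⟨h₀, H⟩ (_ | t) h
        · exact h₀
        · exact H t (Nat.lt_of_succ_lt_succ h)
    have hcond := and_congr (Iff.refl (StepRel b u x))
      ((and_congr hmid (Iff.refl (StepRel c (σ ⟨l.length, Nat.lt_succ_self _⟩) w))).trans
        and_assoc)
    refine Eq.trans ?_ (@if_congr _ _ _ (_) (Classical.dec _) _ _ _ _ hcond
      (congrArg (X ^ ·) hwt) rfl).symm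
    simp only [pow_add, Nat.add_sub_cancel]
    by_cases h : StepRel b u x <;> simp [h]

/-- The entries of the step matrix product along a border strip are weight generating functions
of P-partitions with conditions on the first and last parts. -/
theorem stepProd_fullSteps (m : ℕ) {a : List ℕ} (ha : a ≠ []) (hpos : ∀ x ∈ a, 0 < x)
    (hN : 0 < boxCount a) (u w : Fin (m + 1)) :
    stepProd m (fullSteps a true) u.rev w.rev =
      X ^ (w : ℕ) * PPgen m a (fun σ => (σ ⟨0, hN⟩ : ℕ) ≤ u ∧
        StepRel (if Even a.length then false else true)
          (σ ⟨boxCount a - 1, Nat.sub_lt hN Nat.one_pos⟩) w) := by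
  classical
  rw [fullSteps_eq ha hpos hN,
    stepProd_eq_sum m (steps a) _ _ u w (boxCount a) hN (by rw [length_steps]; omega),
    ← sum_filter, PPgen]
  congr 1
  refine sum_congr ?_ fun _ _ => rfl
  ext σ
  simp only [PP, mem_filter, mem_univ, true_and]
  exact and_left_comm

end QHCF

/-- Theorem: q-matrix formula.  For the border strip
`𝒢 = 𝒢[a₁,…,aₙ]` and `X_𝒢(q) = Λ⁺_m(q,a₁)Λ⁻_m(q,a₂)Λ⁺_m(q,a₃)⋯` (1-based indices):
if `n` is even then `X_𝒢(q)_{ij} = q^{m+1−j}·Ω_m^{ij}(𝒢,q)`, and if `n` is odd then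
`X_𝒢(q)_{ij} = q^{j−1}·Ω̄_m^{ij}(𝒢,q)`. -/
theorem statement9 (m : ℕ) (hm : 1 ≤ m) (a : List ℕ) (ha : a ≠ [])
    (hpos : ∀ x ∈ a, 0 < x) (hN : 0 < boxCount a)
    (i j : ℕ) (hi1 : 1 ≤ i) (hi2 : i ≤ m + 1) (hj1 : 1 ≤ j) (hj2 : j ≤ m + 1) :
    (Even a.length →
      XG m a ⟨i - 1, by omega⟩ ⟨j - 1, by omega⟩ =
        X ^ (m + 1 - j) * PPgen m a (fun σ =>
          (σ ⟨0, hN⟩ : ℕ) ≤ m + 1 - i ∧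
          (σ ⟨boxCount a - 1, Nat.sub_lt hN Nat.one_pos⟩ : ℕ) ≤ m + 1 - j)) ∧
    (¬ Even a.length →
      XG m a ⟨i - 1, by omega⟩ ⟨j - 1, by omega⟩ =
        X ^ (j - 1) * PPgen m a (fun σ =>
          (σ ⟨0, hN⟩ : ℕ) ≤ m + 1 - i ∧
          j - 1 ≤ (σ ⟨boxCount a - 1, Nat.sub_lt hN Nat.one_pos⟩ : ℕ))) := by
  have hi : (⟨i - 1, by omega⟩ : Fin (m + 1)) = Fin.rev ⟨m + 1 - i, by omega⟩ := by
    ext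
    simp only [Fin.val_rev]
    omega
  constructor
  · intro he
    have hj : (⟨j - 1, by omega⟩ : Fin (m + 1)) = Fin.rev ⟨m + 1 - j, by omega⟩ := by
      ext
      simp only [Fin.val_rev]
      omega
    rw [XG, (altLam_eq_stepProd m a).1, if_pos he, mul_one, hi, hj,
      stepProd_fullSteps m ha hpos hN]
    simp [he, StepRel]
  · intro he
    rw [XG, (altLam_eq_stepProd m a).1, if_neg he, mul_WmatQ_apply, hi,
      stepProd_fullSteps m ha hpos hN]
    simp [he, StepRel]
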